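/- For any g_1 ∈ Fh_{fun_1}(28), |(g_1 + Fh_{fun_1}(28)) ∩ S_16| = 7; for any g_2 ∈ Fh_{fun_2}(26), |(g_2 + Fh_{fun_2}(26)) ∩ S_16| = 55; and for any g_4 ∈ Fh_{fun_4}(26), |(g_4 + Fh_{fun_4}(26)) ∩ S_16| = 21. Here g + S denotes the set {g + h : h ∈ S}. -/

import Mathlib

open scoped BigOperators

/-- Boolean functions in `n` variables. -/
abbrev BF (n : ℕ) := (Fin n → ZMod 2) → ZMod 2

/-- Hamming distance between two Boolean functions. -/
def hd {n : ℕ} (f g : BF n) : ℕ :=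
  (Finset.univ.filter (fun x : Fin n → ZMod 2 => f x ≠ g x)).card

/-- The Reed--Muller code `RM(r,n)`: Boolean functions given by evaluation of a
multivariate polynomial over `F_2` of total degree at most `r`. -/
def RM (r n : ℕ) : Set (BF n) :=
  {f | ∃ p : MvPolynomial (Fin n) (ZMod 2),
    p.totalDegree ≤ r ∧ ∀ x, f x = MvPolynomial.eval x p}

/-- The `r`-th order nonlinearity of a Boolean function. -/
noncomputable def nl (r : ℕ) {n : ℕ} (f : BF n) : ℕ :=
  sInf {d | ∃ g ∈ RM r n, d = hd f g}

/-- Concatenation `f1 || f2` of two Boolean functions. -/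
def concat {n : ℕ} (f1 f2 : BF n) : BF (n + 1) :=
  fun x => (1 + x (Fin.last n)) * f1 (x ∘ Fin.castSucc)
    + x (Fin.last n) * f2 (x ∘ Fin.castSucc)

/-- A Boolean function is homogeneous quadratic if it is of the form
`∑_{i<j} a_{ij} x_i x_j`. -/
def HomQuad {n : ℕ} (g : BF n) : Prop :=
  ∃ a : Fin n → Fin n → ZMod 2,
    ∀ x, g x = ∑ i : Fin n, ∑ j : Fin n, (if i < j then a i j * x i * x j else 0)

/-- `Fh f r` is the set of homogeneous quadratic functions `g` with `nl(f+g) = r`. -/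
def Fh {n : ℕ} (f : BF n) (r : ℕ) : Set (BF n) :=
  {g | HomQuad g ∧ nl 1 (f + g) = r}

/-- `NFh f r = |Fh f r|`. -/
noncomputable def NFh {n : ℕ} (f : BF n) (r : ℕ) : ℕ := (Fh f r).ncard

/-- The set of 6-variable Boolean functions with nonlinearity 16. -/
def S16 : Set (BF 6) := {f | nl 1 f = 16}

/-- `f1` and `f2` are affine equivalent modulo `RM(r,n)`. -/
def AffEquivMod (r n : ℕ) (f1 f2 : BF n) : Prop :=
  ∃ A : Matrix (Fin n) (Fin n) (ZMod 2), IsUnit A ∧ ∃ b : Fin n → ZMod 2,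
    (fun x => f1 x + f2 (A.mulVec x + b)) ∈ RM r n

def fun1 : BF 6 := fun x => x 0*x 1*x 5 + x 0*x 2*x 4 + x 1*x 2*x 3

def fun2 : BF 6 := fun x => x 0*x 1*x 2*x 3 + x 0*x 1*x 5 + x 0*x 3*x 4 + x 1*x 2*x 4

def fun3 : BF 6 := fun x => x 0*x 1*x 2*x 3 + x 0*x 2*x 4 + x 0*x 3*x 5 + x 1*x 2*x 4
  + x 1*x 2*x 5 + x 1*x 3*x 4

def fun4 : BF 6 := fun x => x 0*x 1*x 2*x 5 + x 0*x 1*x 3*x 4 + x 0*x 2*x 4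
  + x 0*x 3*x 4 + x 0*x 3*x 5 + x 1*x 2*x 3

def fun5 : BF 6 := fun x => x 0*x 1*x 2*x 3*x 4 + x 0*x 2*x 4 + x 0*x 3*x 5
  + x 1*x 2*x 4 + x 1*x 2*x 5 + x 1*x 3*x 4

def fun6 : BF 6 := fun x => x 0*x 1*x 2*x 3*x 4*x 5 + x 0*x 1*x 5 + x 0*x 2*x 4
  + x 1*x 2*x 3

def fun7 : BF 6 := fun x => x 0*x 1*x 2*x 3*x 4*x 5 + x 0*x 1*x 2*x 3 + x 0*x 1*x 5
  + x 0*x 3*x 4 + x 1*x 2*x 4 + x 3*x 4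

def fun8 : BF 6 := fun x => x 0*x 1*x 2*x 3*x 4*x 5 + x 0*x 1*x 2*x 3 + x 0*x 2*x 4
  + x 0*x 3*x 5 + x 1*x 2*x 4 + x 1*x 2*x 5 + x 1*x 3*x 4

def fun9 : BF 6 := fun x => x 0*x 1*x 2*x 3*x 4*x 5 + x 0*x 1*x 2*x 5 + x 0*x 1*x 3*x 4
  + x 0*x 2*x 4 + x 0*x 3*x 4 + x 0*x 3*x 5 + x 1*x 2*x 3 + x 3*x 5

def fun10 : BF 6 := fun x => x 0*x 1*x 2*x 3*x 4*x 5 + x 0*x 1*x 2*x 3 + x 0*x 2*x 3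
  + x 0*x 4*x 5 + x 1*x 2*x 3 + x 1*x 2*x 5 + x 1*x 3*x 4 + x 2*x 3 + x 2*x 5 + x 3*x 4

def fun11 : BF 6 := fun x => x 0*x 1*x 2*x 3*x 4*x 5 + x 0*x 1*x 2*x 5 + x 0*x 1*x 3*x 4
  + x 0*x 2*x 4 + x 0*x 3*x 4 + x 0*x 3*x 5 + x 1*x 2*x 3 + x 1*x 2*x 5 + x 1*x 3*x 4
  + x 2*x 4 + x 3*x 4 + x 3*x 5

def fun12 : BF 6 := fun x => x 0*x 1*x 2*x 3*x 4*x 5 + x 1*x 2*x 3*x 4 + x 0*x 1*x 4*x 5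
  + x 0*x 2*x 3*x 5 + x 0*x 1*x 3 + x 0*x 1*x 4 + x 1*x 2*x 4 + x 2*x 3*x 4
  + x 0*x 1*x 5 + x 2*x 3*x 5

def g0 : BF 6 := fun x => x 0*x 1*x 2 + x 0*x 3*x 4 + x 1*x 3*x 5 + x 2*x 4*x 5
  + x 3*x 4*x 5

/-- Continue with `k` applied to the evaluated numeral `n`, so that the kernel computes `n` once. -/
def force {α : Type*} (n : ℕ) (k : ℕ → α) : α :=
  Nat.rec (k 0) (fun m _ => k (m + 1)) n

theorem force_eq {α : Type*} (n : ℕ) (k : ℕ → α) : force n k = k n := by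
  cases n <;> rfl

/-- The `F_2`-linear form with coefficient list `ms`, evaluated at the bits of `c`; the head of `ms`
belongs to the most significant bit. -/
def bitForm : List Bool → ℕ → Bool
  | [], _ => false
  | m :: ms, c => (m && c.testBit ms.length) ^^ bitForm ms c

/-- The number with `2 ^ k` lanes of 16 bits, all equal to one. -/
def onesLanes : ℕ → ℕ
  | 0 => 1
  | k + 1 => force (onesLanes k) fun a => a + a <<< (16 * 2 ^ k)

/-- The number whose `q`-th lane is `bitForm ms q`. -/
def bitFormLanes : List Bool → ℕ
  | [] => 0
  | m :: ms => force (bitFormLanes ms) fun a =>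
      a + (bif m then onesLanes ms.length - a else a) <<< (16 * 2 ^ ms.length)

def coordMask (k : ℕ) : ℕ :=
  bitFormLanes [k == 14, k == 13, k == 12, k == 11, k == 10, k == 9, k == 8, k == 7, k == 6,
    k == 5, k == 4, k == 3, k == 2, k == 1, k == 0]

/-- Exchange lanes whose indices differ in bit `k`. -/
def flipLane (k M : ℕ) : ℕ :=
  ((M &&& coordMask k) >>> (16 * 2 ^ k)) |||
    ((M &&& (onesLanes 15 ^^^ coordMask k)) <<< (16 * 2 ^ k))

def quadMonos (p : ℕ) : List Bool :=
  let x := p.testBit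
  [x 0 && x 1, x 0 && x 2, x 0 && x 3, x 0 && x 4, x 0 && x 5, x 1 && x 2, x 1 && x 3, x 1 && x 4,
    x 1 && x 5, x 2 && x 3, x 2 && x 4, x 2 && x 5, x 3 && x 4, x 3 && x 5, x 4 && x 5]

/-- The scalar product of the lowest `k` bits of `a` and `i`. -/
def bitDot : ℕ → ℕ → ℕ → Bool
  | 0, _, _ => false
  | k + 1, a, i => (a.testBit k && i.testBit k) ^^ bitDot k a i

/-- Lane `c` counts the points among `2 ^ k * p + i`, `i < 2 ^ k`, at which `F` plus the `c`-th
quadratic form differs from the linear function `bitDot k a` of `i`. -/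
def blockLanes (F : ℕ → Bool) : ℕ → ℕ → ℕ → ℕ
  | 0, p, _ =>
    bif F p then onesLanes 15 - bitFormLanes (quadMonos p) else bitFormLanes (quadMonos p)
  | k + 1, p, a => force (2 * p) fun p₀ => force (2 * p + 1) fun p₁ => force (a % 2 ^ k) fun b =>
      blockLanes F k p₀ b + bif a.testBit k then 2 ^ k * onesLanes 15 - blockLanes F k p₁ b
        else blockLanes F k p₁ b

/-- Lane `c` is the distance of `F` plus the `c`-th quadratic form to the `a`-th affine function. -/
def distLanes (F : ℕ → Bool) (a : ℕ) : ℕ :=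
  force (a % 2 ^ 6) fun b =>
    bif a.testBit 6 then 2 ^ 6 * onesLanes 15 - blockLanes F 6 0 b else blockLanes F 6 0 b

/-- Lane `c` tells whether the distances to the first `n` affine functions are all at least `r`. -/
def geLanes (F : ℕ → Bool) (r : ℕ) : ℕ → ℕ
  | 0 => onesLanes 15
  | n + 1 => geLanes F r n &&&
      ((distLanes F n + (128 - r) * onesLanes 15) >>> 7 &&& onesLanes 15)

/-- Lane `c` tells whether `F` plus the `c`-th quadratic form has nonlinearity `r`. -/
def nlLanes (F : ℕ → Bool) (r : ℕ) : ℕ :=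
  geLanes F r 128 &&& (onesLanes 15 ^^^ geLanes F (r + 1) 128)

/-- Run `f` on all nonzero blocks of `2 ^ j` lanes of `S`, together with an index of the block and
the translate of `M` by the index of the first lane of the block. -/
def forallBlocks (f : ℕ → ℕ → ℕ → Bool) (j : ℕ) : ℕ → ℕ → ℕ → ℕ → Bool
  | 0, i, S, M => Nat.beq S 0 || f i S M
  | k + 1, i, S, M =>
      (force (S % 2 ^ (16 * 2 ^ (j + k))) fun S₀ =>
        Nat.beq S₀ 0 || forallBlocks f j k (2 * i) S₀ M) &&
      force (S >>> (16 * 2 ^ (j + k))) fun S₁ =>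
        Nat.beq S₁ 0 || force (flipLane (j + k) M) fun M₁ => forallBlocks f j k (2 * i + 1) S₁ M₁

/-- For all lanes `g` of `T` equal to one, check that `T` and the translate of `R` by `g` have `N`
common lanes equal to one. The lower half of `g` is moved to `T` to save work, and the summand
`0 * i` keeps the terms with large numerals apart in the cache of the kernel. -/
def translatesCheck (T R N : ℕ) : Bool :=
  forallBlocks (fun i S R' =>
    forallBlocks (fun _ _ T' => Nat.beq ((T' &&& (R' + 0 * i)) % 65535) N) 0 7 0 S T) 7 8 0 T R

def nlCheck (F : ℕ → Bool) (r N : ℕ) : Bool :=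
  force (nlLanes F r) fun T => force (nlLanes (fun _ => false) 16) fun R => translatesCheck T R N

def boolFun1 (p : ℕ) : Bool :=
  let x := p.testBit
  (x 0 && x 1 && x 5) ^^ (x 0 && x 2 && x 4) ^^ (x 1 && x 2 && x 3)

def boolFun2 (p : ℕ) : Bool :=
  let x := p.testBit
  (x 0 && x 1 && x 2 && x 3) ^^ (x 0 && x 1 && x 5) ^^ (x 0 && x 3 && x 4) ^^
    (x 1 && x 2 && x 4)

def boolFun4 (p : ℕ) : Bool :=
  let x := p.testBit
  (x 0 && x 1 && x 2 && x 5) ^^ (x 0 && x 1 && x 3 && x 4) ^^ (x 0 && x 2 && x 4) ^^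
    (x 0 && x 3 && x 4) ^^ (x 0 && x 3 && x 5) ^^ (x 1 && x 2 && x 3)

/-- The number whose first `n` lanes of 16 bits are the values of `v`. -/
@[irreducible] def pack (n : ℕ) (v : ℕ → ℕ) : ℕ := ∑ q ∈ Finset.range n, v q * 2 ^ (16 * q)

theorem pack_congr {n : ℕ} {v w : ℕ → ℕ} (h : ∀ q < n, v q = w q) : pack n v = pack n w := by
  rw [pack, pack]
  exact Finset.sum_congr rfl fun q hq => by rw [h q (Finset.mem_range.1 hq)]

theorem pack_add (n : ℕ) (v w : ℕ → ℕ) : pack n v + pack n w = pack n fun q => v q + w q := by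
  simp only [pack, ← Finset.sum_add_distrib, add_mul]

theorem mul_pack (n c : ℕ) (v : ℕ → ℕ) : c * pack n v = pack n fun q => c * v q := by
  simp only [pack, Finset.mul_sum, mul_assoc]

theorem pack_sub {n : ℕ} {v w : ℕ → ℕ} (h : ∀ q < n, w q ≤ v q) :
    pack n v - pack n w = pack n fun q => v q - w q := by
  have hle : pack n w ≤ pack n v := by
    rw [pack, pack]
    exact Finset.sum_le_sum fun q hq =>
      Nat.mul_le_mul_right _ (h q (Finset.mem_range.1 hq))
  rw [Nat.sub_eq_iff_eq_add' hle, pack_add]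
  exact pack_congr fun q hq => by have := h q hq; omega

theorem pack_append (m n : ℕ) (v : ℕ → ℕ) :
    pack (m + n) v = pack m v + (pack n fun q => v (m + q)) <<< (16 * m) := by
  simp only [pack, Finset.sum_range_add, Nat.shiftLeft_eq, Finset.sum_mul]
  congr 1
  exact Finset.sum_congr rfl fun q _ => by ring

theorem pack_lt {n : ℕ} {v : ℕ → ℕ} (h : ∀ q < n, v q < 2 ^ 16) : pack n v < 2 ^ (16 * n) := by
  induction n with
  | zero => simp [pack]
  | succ n ih =>
    have h₁ := ih fun q hq => h q (by omega)
    have h₂ := h n (by omega)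
    rw [pack, Finset.sum_range_succ, ← pack, mul_add, pow_add, mul_one]
    nlinarith [Nat.mul_le_mul_right (2 ^ (16 * n)) (Nat.succ_le_of_lt h₂)]

theorem testBit_pack {n : ℕ} {v : ℕ → ℕ} (h : ∀ q < n, v q < 2 ^ 16) (i : ℕ) :
    (pack n v).testBit i = (decide (i / 16 < n) && (v (i / 16)).testBit (i % 16)) := by
  induction n with
  | zero => simp [pack]
  | succ n ih =>
    have h₁ := fun q (hq : q < n) => h q (by omega)
    rw [pack, Finset.sum_range_succ, ← pack, add_comm, mul_comm,
      Nat.testBit_two_pow_mul_add _ (pack_lt h₁), ih h₁]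
    split_ifs with hi
    · simp [show i / 16 < n by omega, show i / 16 < n + 1 by omega]
    · rcases Nat.lt_or_ge (i / 16) (n + 1) with hn | hn
      · have : i / 16 = n := by omega
        simp [this, show i - 16 * n = i % 16 by omega]
      · have : v n < 2 ^ (i - 16 * n) :=
          (h n (by omega)).trans_le (Nat.pow_le_pow_right (by omega) (by omega))
        simp [show ¬ i / 16 < n + 1 by omega, Nat.testBit_lt_two_pow this]

/-- The number whose first `2 ^ 15` lanes are the truth values of `v`. -/
def laneMask (v : ℕ → Bool) : ℕ := pack (2 ^ 15) fun q => (v q).toNat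

theorem testBit_laneMask (v : ℕ → Bool) (i : ℕ) :
    (laneMask v).testBit i = (decide (i % 16 = 0) && decide (i / 16 < 2 ^ 15) && v (i / 16)) := by
  rw [laneMask, testBit_pack fun q _ => (Bool.toNat_lt _).trans (by norm_num),
    Nat.testBit_bool_toNat, Bool.and_left_comm, Bool.and_assoc]

theorem laneMask_and (v w : ℕ → Bool) :
    laneMask v &&& laneMask w = laneMask fun q => v q && w q :=
  Nat.eq_of_testBit_eq fun i => by
    simp only [Nat.testBit_and, testBit_laneMask]
    grind

theorem laneMask_xor (v w : ℕ → Bool) :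
    laneMask v ^^^ laneMask w = laneMask fun q => v q ^^ w q :=
  Nat.eq_of_testBit_eq fun i => by
    simp only [Nat.testBit_xor, testBit_laneMask]
    grind

theorem pack_modEq (n : ℕ) (v : ℕ → ℕ) : pack n v ≡ ∑ q ∈ Finset.range n, v q [MOD 65535] := by
  rw [pack]
  refine Nat.ModEq.sum fun q _ => ?_
  have := ((show 2 ^ 16 ≡ 1 [MOD 65535] by decide).pow q).mul_left (v q)
  rwa [← pow_mul, one_pow, mul_one] at this

theorem laneMask_mod (v : ℕ → Bool) :
    laneMask v % 65535 = ((Finset.range (2 ^ 15)).filter fun q => v q = true).card := by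
  have hc : ∑ q ∈ Finset.range (2 ^ 15), (v q).toNat =
      ((Finset.range (2 ^ 15)).filter fun q => v q = true).card := by
    rw [Finset.card_filter]
    exact Finset.sum_congr rfl fun q _ => by cases v q <;> rfl
  refine Nat.mod_eq_of_modEq (hc ▸ pack_modEq _ _) ?_
  exact (Finset.card_filter_le _ _).trans_lt (by rw [Finset.card_range]; norm_num)

theorem onesLanes_eq (k : ℕ) : onesLanes k = pack (2 ^ k) fun _ => 1 := by
  induction k with
  | zero => simp [onesLanes, pack]
  | succ k ih => rw [onesLanes, force_eq, pow_succ, mul_two, pack_append, ih]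

theorem onesLanes_eq_laneMask : onesLanes 15 = laneMask fun _ => true := onesLanes_eq 15

theorem bitForm_two_pow_add {ms : List Bool} {k : ℕ} (h : ms.length ≤ k) (q : ℕ) :
    bitForm ms (2 ^ k + q) = bitForm ms q := by
  induction ms with
  | nil => rfl
  | cons m ms ih =>
    rw [List.length_cons] at h
    rw [bitForm, bitForm, ih (by omega), Nat.testBit_two_pow_add_gt (by omega)]

theorem bitFormLanes_eq (ms : List Bool) :
    bitFormLanes ms = pack (2 ^ ms.length) fun q => (bitForm ms q).toNat := by
  induction ms with
  | nil => simp [bitFormLanes, pack, bitForm]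
  | cons m ms ih =>
    rw [bitFormLanes, force_eq, List.length_cons, pow_succ, mul_two, pack_append, ih, onesLanes_eq,
      pack_sub fun _ _ => Bool.toNat_le _]
    congr 1
    · refine pack_congr fun q hq => ?_
      simp [bitForm, Nat.testBit_lt_two_pow hq]
    · congr 1
      cases m
      · refine pack_congr fun q hq => ?_
        simp [bitForm, bitForm_two_pow_add]
      · refine pack_congr fun q hq => ?_
        rw [bitForm, Nat.testBit_two_pow_add_eq, Nat.testBit_lt_two_pow hq,
          bitForm_two_pow_add le_rfl]
        cases bitForm ms q <;> rfl

theorem coordMask_eq {k : ℕ} (hk : k < 15) : coordMask k = laneMask fun q => q.testBit k := by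
  rw [coordMask, bitFormLanes_eq]
  refine pack_congr fun q _ => ?_
  interval_cases k <;> simp [bitForm]

theorem xor_two_pow_eq_add {k q : ℕ} (h : q.testBit k = false) : q ^^^ 2 ^ k = 2 ^ k + q := by
  induction k generalizing q with
  | zero =>
    rw [Nat.testBit_zero] at h
    have h₁ := Nat.xor_div_two (a := q) (b := 1)
    have h₂ := Nat.xor_mod_two_eq (m := q) (n := 1)
    rw [show 1 / 2 = 0 by rfl, Nat.xor_zero] at h₁
    rw [decide_eq_false_iff_not] at h
    rw [pow_zero]
    omega
  | succ k ih =>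
    rw [Nat.testBit_succ] at h
    have h₁ := Nat.xor_div_two (a := q) (b := 2 ^ (k + 1))
    have h₂ := Nat.xor_mod_two_eq (m := q) (n := 2 ^ (k + 1))
    rw [show 2 ^ (k + 1) / 2 = 2 ^ k by omega, ih h] at h₁
    omega

theorem flipLane_laneMask {k : ℕ} (hk : k < 15) (v : ℕ → Bool) :
    flipLane k (laneMask v) = laneMask fun q => v (q ^^^ 2 ^ k) := by
  rw [flipLane, coordMask_eq hk, onesLanes_eq_laneMask, laneMask_xor, laneMask_and, laneMask_and]
  refine Nat.eq_of_testBit_eq fun i => ?_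
  simp only [Nat.testBit_or, Nat.testBit_shiftRight, Nat.testBit_shiftLeft, testBit_laneMask,
    Nat.mul_add_mod, Nat.mul_add_div (show 0 < 16 by norm_num)]
  rcases Nat.eq_zero_or_pos (i % 16) with hi | hi
  swap
  · have : i ≥ 16 * 2 ^ k → (i - 16 * 2 ^ k) % 16 ≠ 0 := by omega
    grind
  obtain ⟨q, rfl⟩ : ∃ q, i = 16 * q := ⟨i / 16, by omega⟩
  have e₁ : 16 * q - 16 * 2 ^ k = 16 * (q - 2 ^ k) := by omega
  have e₂ : 16 * q ≥ 16 * 2 ^ k ↔ 2 ^ k ≤ q := by omega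
  have hk' : 2 ^ k < 2 ^ 15 := Nat.pow_lt_pow_right (by norm_num) hk
  simp only [e₁, e₂, Nat.mul_mod_right, Nat.mul_div_cancel_left q (show 0 < 16 by norm_num),
    Nat.mul_div_cancel_left (q - 2 ^ k) (show 0 < 16 by norm_num), Nat.testBit_two_pow_add_eq]
  have hlt : q ^^^ 2 ^ k < 2 ^ 15 ↔ q < 2 ^ 15 :=
    ⟨fun h => by simpa [Nat.xor_assoc] using Nat.xor_lt_two_pow h hk',
      fun h => Nat.xor_lt_two_pow h hk'⟩
  have hd : decide (q ^^^ 2 ^ k < 2 ^ 15) = decide (q < 2 ^ 15) := by simp only [hlt]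
  cases hq : q.testBit k with
  | false =>
    have hx := xor_two_pow_eq_add hq
    have hr : 2 ^ k ≤ q → (q - 2 ^ k).testBit k = true := fun hle => by
      have := Nat.testBit_two_pow_add_eq (q - 2 ^ k) k
      rw [Nat.add_sub_cancel' hle, hq] at this
      simpa using this
    rw [hx] at hd ⊢
    rw [hd]
    by_cases hle : 2 ^ k ≤ q <;> simp [hle, hr]
  | true =>
    have hle := Nat.ge_two_pow_of_testBit hq
    have hr : (q - 2 ^ k).testBit k = false := by
      have := Nat.testBit_two_pow_add_eq (q - 2 ^ k) k
      rw [Nat.add_sub_cancel' hle, hq] at this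
      simpa using this
    have hx : q ^^^ 2 ^ k = q - 2 ^ k := by
      have := xor_two_pow_eq_add hr
      rw [Nat.add_sub_cancel' hle] at this
      conv_lhs => rw [← this, Nat.xor_assoc, Nat.xor_self, Nat.xor_zero]
    rw [hx] at hd ⊢
    rw [hd]
    simp [hle, hr]

theorem forallBlocks_spec {f : ℕ → ℕ → ℕ → Bool} {j k i S g c : ℕ} {v : ℕ → Bool}
    (hjk : j + k ≤ 15) (h : forallBlocks f j k i S (laneMask v) = true) (hg : g < 2 ^ k)
    (hc : c < 2 ^ j) (hS : S.testBit (16 * (2 ^ j * g + c)) = true) :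
    ∃ i' S', S'.testBit (16 * c) = true ∧
      f i' S' (laneMask fun q => v (q ^^^ 2 ^ j * g)) = true := by
  induction k generalizing i S g v with
  | zero =>
    obtain rfl : g = 0 := by simpa using hg
    have hS₀ : S ≠ 0 := by rintro rfl; simp at hS
    simp only [forallBlocks, Bool.or_eq_true, Nat.beq_eq, hS₀, false_or] at h
    exact ⟨i, S, by simpa using hS, by simpa using h⟩
  | succ k ih =>
    simp only [forallBlocks, force_eq, Bool.and_eq_true, Bool.or_eq_true, Nat.beq_eq,
      flipLane_laneMask (show j + k < 15 by omega)] at h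
    obtain ⟨h₀, h₁⟩ := h
    rcases Nat.lt_or_ge g (2 ^ k) with hgk | hgk
    · have hS' : (S % 2 ^ (16 * 2 ^ (j + k))).testBit (16 * (2 ^ j * g + c)) = true := by
        rw [Nat.testBit_mod_two_pow, hS, Bool.and_true, decide_eq_true_iff, pow_add]
        nlinarith [Nat.mul_le_mul_left (2 ^ j) (Nat.succ_le_of_lt hgk)]
      refine ih (by omega) (h₀.resolve_left ?_) hgk hS'
      intro h0
      rw [h0] at hS'
      simp at hS'
    · obtain ⟨g, rfl⟩ := Nat.exists_eq_add_of_le hgk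
      have hg' : g < 2 ^ k := by omega
      have hS' : (S >>> (16 * 2 ^ (j + k))).testBit (16 * (2 ^ j * g + c)) = true := by
        rw [Nat.testBit_shiftRight, ← hS, pow_add]
        congr 1
        ring
      have := ih (by omega) (h₁.resolve_left fun h0 => by rw [h0] at hS'; simp at hS') hg' hS'
      have hlt : 2 ^ j * g < 2 ^ (j + k) := by
        rw [pow_add]
        exact Nat.mul_lt_mul_of_pos_left hg' (Nat.two_pow_pos j)
      have hx := xor_two_pow_eq_add (Nat.testBit_lt_two_pow hlt)
      simpa only [Nat.xor_assoc, hx, mul_add, ← pow_add] using this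

theorem card_filter_xor {n g : ℕ} (hg : g < 2 ^ n) (p : ℕ → Prop) [DecidablePred p] :
    ((Finset.range (2 ^ n)).filter fun q => p (q ^^^ g)).card =
      ((Finset.range (2 ^ n)).filter p).card := by
  refine Finset.card_nbij' (· ^^^ g) (· ^^^ g) ?_ ?_ ?_ ?_ <;> intro q hq <;>
    simp only [Finset.coe_filter, Finset.mem_range, Set.mem_ofPred_eq,
      Nat.xor_xor_cancel_right] at hq ⊢ <;>
    exact ⟨Nat.xor_lt_two_pow hq.1 hg, hq.2⟩

theorem translatesCheck_spec {t v : ℕ → Bool} {N : ℕ}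
    (h : translatesCheck (laneMask t) (laneMask v) N = true) {g : ℕ} (hg : g < 2 ^ 15)
    (htg : t g = true) :
    ((Finset.range (2 ^ 15)).filter fun q => (t q && v (q ^^^ g)) = true).card = N := by
  have hlo : g % 2 ^ 7 < 2 ^ 7 := Nat.mod_lt _ (Nat.two_pow_pos 7)
  obtain ⟨i, S, hS, h₁⟩ := forallBlocks_spec (g := g / 2 ^ 7) (c := g % 2 ^ 7) (by norm_num) h
    (by omega) hlo (by rw [Nat.div_add_mod, testBit_laneMask]; simp [htg]; omega)
  obtain ⟨_, _, _, h₂⟩ := forallBlocks_spec (g := g % 2 ^ 7) (c := 0) (by norm_num) h₁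
    hlo (by norm_num) (by simpa using hS)
  have h₃ := Nat.eq_of_beq_eq_true h₂
  rw [zero_mul, add_zero, laneMask_and, laneMask_mod, pow_zero, one_mul] at h₃
  rw [← h₃, ← card_filter_xor (show g % 2 ^ 7 < 2 ^ 15 by omega)]
  have hx : g % 2 ^ 7 ^^^ g = 2 ^ 7 * (g / 2 ^ 7) := by
    refine Nat.eq_of_testBit_eq fun i => ?_
    simp only [Nat.testBit_xor, Nat.testBit_mod_two_pow, Nat.testBit_two_pow_mul,
      Nat.testBit_div_two_pow]
    rcases Nat.lt_or_ge i 7 with hi | hi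
    · simp [hi]
    · simp [hi, show ¬ i < 7 by omega]
  simp only [Nat.xor_assoc, hx]

theorem bitDot_mod {j k : ℕ} (h : j ≤ k) (a i : ℕ) : bitDot j (a % 2 ^ k) i = bitDot j a i := by
  induction j with
  | zero => rfl
  | succ j ih =>
    simp [bitDot, ih (by omega), Nat.testBit_mod_two_pow, show j < k by omega]

theorem bitDot_two_pow_add {j k : ℕ} (h : j ≤ k) (a i : ℕ) :
    bitDot j a (2 ^ k + i) = bitDot j a i := by
  induction j with
  | zero => rfl
  | succ j ih =>
    rw [bitDot, bitDot, ih (by omega), Nat.testBit_two_pow_add_gt (by omega)]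

/-- The number of `i < 2 ^ k` at which `g (2 ^ k * p + i)` differs from `bitDot k a i`. -/
def blockDist (g : ℕ → Bool) (k p a : ℕ) : ℕ :=
  ∑ i ∈ Finset.range (2 ^ k), (g (2 ^ k * p + i) ^^ bitDot k a i).toNat

theorem sum_toNat_not (n : ℕ) (b : ℕ → Bool) :
    ∑ i ∈ Finset.range n, (!b i).toNat = n - ∑ i ∈ Finset.range n, (b i).toNat := by
  have : ∑ i ∈ Finset.range n, (!b i).toNat + ∑ i ∈ Finset.range n, (b i).toNat = n := by
    rw [← Finset.sum_add_distrib, Finset.sum_congr rfl (g := fun _ => 1), Finset.sum_const,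
      Finset.card_range, smul_eq_mul, mul_one]
    intro i _
    cases b i <;> rfl
  omega

theorem sum_toNat_le (n : ℕ) (b : ℕ → Bool) : ∑ i ∈ Finset.range n, (b i).toNat ≤ n :=
  (Finset.sum_le_card_nsmul _ _ 1 fun _ _ => Bool.toNat_le _).trans (by simp)

theorem blockDist_le (g : ℕ → Bool) (k p a : ℕ) : blockDist g k p a ≤ 2 ^ k := sum_toNat_le _ _

theorem blockDist_succ (g : ℕ → Bool) (k p a : ℕ) :
    blockDist g (k + 1) p a = blockDist g k (2 * p) (a % 2 ^ k) +
      bif a.testBit k then 2 ^ k - blockDist g k (2 * p + 1) (a % 2 ^ k)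
        else blockDist g k (2 * p + 1) (a % 2 ^ k) := by
  rw [blockDist, pow_succ, mul_two, Finset.sum_range_add]
  simp only [blockDist, bitDot_mod le_rfl]
  congr 1
  · refine Finset.sum_congr rfl fun i hi => ?_
    rw [bitDot, Nat.testBit_lt_two_pow (Finset.mem_range.1 hi), Bool.and_false, Bool.false_xor]
    congr 3
    ring
  · have e : ∀ i, (2 ^ k + 2 ^ k) * p + (2 ^ k + i) = 2 ^ k * (2 * p + 1) + i := fun i => by ring
    cases ha : a.testBit k
    · refine Finset.sum_congr rfl fun i hi => ?_
      rw [bitDot, ha, bitDot_two_pow_add le_rfl, e, Bool.false_and, Bool.false_xor]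
    · rw [cond_true, ← sum_toNat_not]
      refine Finset.sum_congr rfl fun i hi => ?_
      rw [bitDot, ha, bitDot_two_pow_add le_rfl, e, Nat.testBit_two_pow_add_eq,
        Nat.testBit_lt_two_pow (Finset.mem_range.1 hi)]
      simp

/-- The sum of `F` and the `c`-th quadratic form. -/
def addQuad (F : ℕ → Bool) (c p : ℕ) : Bool := F p ^^ bitForm (quadMonos p) c

theorem complement_pack (b : Bool) {c : ℕ} (m : ℕ) {w : ℕ → ℕ} (h : ∀ q, w q ≤ c) :
    (bif b then c * onesLanes m - pack (2 ^ m) w else pack (2 ^ m) w) =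
      pack (2 ^ m) fun q => bif b then c - w q else w q := by
  cases b
  · rfl
  · simp only [cond_true, onesLanes_eq, mul_pack, mul_one, pack_sub fun q _ => h q]

theorem blockLanes_eq (F : ℕ → Bool) (k p a : ℕ) :
    blockLanes F k p a = pack (2 ^ 15) fun c => blockDist (addQuad F c) k p a := by
  induction k generalizing p a with
  | zero =>
    have hlen : (quadMonos p).length = 15 := rfl
    rw [blockLanes, bitFormLanes_eq, hlen, ← one_mul (onesLanes 15),
      complement_pack _ _ fun _ => Bool.toNat_le _]
    refine pack_congr fun c _ => ?_
    simp only [blockDist, addQuad, bitDot]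
    cases hF : F p <;> cases hb : bitForm (quadMonos p) c <;> simp [hF, hb]
  | succ k ih =>
    rw [blockLanes, force_eq, force_eq, force_eq, ih, ih,
      complement_pack _ _ fun _ => blockDist_le _ _ _ _, pack_add]
    simp only [blockDist_succ]

/-- The `a`-th affine function. -/
def affFun (a p : ℕ) : Bool := a.testBit 6 ^^ bitDot 6 a p

/-- The distance from `g` to the `a`-th affine function. -/
def affDist (g : ℕ → Bool) (a : ℕ) : ℕ := ∑ p ∈ Finset.range 64, (g p ^^ affFun a p).toNat

theorem distLanes_eq (F : ℕ → Bool) (a : ℕ) :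
    distLanes F a = pack (2 ^ 15) fun c => affDist (addQuad F c) a := by
  have hd : ∀ g, affDist g a = bif a.testBit 6 then 2 ^ 6 - blockDist g 6 0 (a % 2 ^ 6)
      else blockDist g 6 0 (a % 2 ^ 6) := fun g => by
    simp only [blockDist, affDist, affFun, bitDot_mod le_rfl, mul_zero, zero_add, ← sum_toNat_not]
    cases a.testBit 6 <;> simp
  rw [distLanes, force_eq, blockLanes_eq, complement_pack _ _ fun _ => blockDist_le _ _ _ _]
  simp only [hd]

theorem thresholdLanes_eq {d : ℕ → ℕ} (hd : ∀ c, d c ≤ 64) {r : ℕ} (hr : r ≤ 64) :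
    (pack (2 ^ 15) d + (128 - r) * onesLanes 15) >>> 7 &&& onesLanes 15 =
      laneMask fun c => decide (r ≤ d c) := by
  refine Nat.eq_of_testBit_eq fun i => ?_
  rw [onesLanes_eq, mul_pack, pack_add, ← onesLanes_eq, onesLanes_eq_laneMask, Nat.testBit_and,
    Nat.testBit_shiftRight, testBit_laneMask, testBit_laneMask,
    testBit_pack fun c _ => by have := hd c; norm_num; omega]
  by_cases hi : i % 16 = 0
  · have := hd (i / 16)
    rw [show (7 + i) / 16 = i / 16 by omega, show (7 + i) % 16 = 7 by omega,
      Nat.testBit_eq_decide_div_mod_eq]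
    have : (d (i / 16) + (128 - r) * 1) / 2 ^ 7 % 2 = 1 ↔ r ≤ d (i / 16) := by omega
    simp only [hi, this]
    simp [Bool.and_comm]
  · simp [hi]

theorem affDist_le (g : ℕ → Bool) (a : ℕ) : affDist g a ≤ 64 := sum_toNat_le _ _

theorem geLanes_eq (F : ℕ → Bool) {r : ℕ} (hr : r ≤ 64) (n : ℕ) :
    geLanes F r n = laneMask fun c => decide (∀ a < n, r ≤ affDist (addQuad F c) a) := by
  induction n with
  | zero => simp [geLanes, onesLanes_eq_laneMask]
  | succ n ih =>
    rw [geLanes, ih, distLanes_eq, thresholdLanes_eq (fun _ => affDist_le _ _) hr, laneMask_and]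
    simp only [Nat.forall_lt_succ_right, Bool.decide_and]

/-- `g` has nonlinearity `r`. -/
def HasNl (g : ℕ → Bool) (r : ℕ) : Prop :=
  (∀ a < 128, r ≤ affDist g a) ∧ ¬ ∀ a < 128, r + 1 ≤ affDist g a

instance (g : ℕ → Bool) (r : ℕ) : Decidable (HasNl g r) := by
  unfold HasNl
  infer_instance

theorem nlLanes_eq (F : ℕ → Bool) {r : ℕ} (hr : r < 64) :
    nlLanes F r = laneMask fun c => decide (HasNl (addQuad F c) r) := by
  rw [nlLanes, geLanes_eq F hr.le, geLanes_eq F (Nat.succ_le_of_lt hr), onesLanes_eq_laneMask,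
    laneMask_xor, laneMask_and]
  congr 1
  funext c
  rw [Bool.true_xor, Bool.eq_iff_iff, Bool.and_eq_true, Bool.not_eq_true', decide_eq_true_iff,
    decide_eq_true_iff, decide_eq_false_iff_not, HasNl]

theorem nlCheck_spec {F : ℕ → Bool} {r N : ℕ} (hr : r < 64) (h : nlCheck F r N = true) {g : ℕ}
    (hg : g < 2 ^ 15) (hFg : HasNl (addQuad F g) r) :
    ((Finset.range (2 ^ 15)).filter fun c =>
      HasNl (addQuad F c) r ∧ HasNl (addQuad (fun _ => false) (c ^^^ g)) 16).card = N := by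
  rw [nlCheck, force_eq, force_eq, nlLanes_eq F hr, nlLanes_eq _ (by norm_num)] at h
  simpa using translatesCheck_spec h hg (decide_eq_true hFg)

theorem nlCheck_boolFun1 : nlCheck boolFun1 28 7 = true := by
  decide +kernel

theorem nlCheck_boolFun2 : nlCheck boolFun2 26 55 = true := by
  decide +kernel

theorem nlCheck_boolFun4 : nlCheck boolFun4 26 21 = true := by
  decide +kernel

def toZMod (b : Bool) : ZMod 2 := if b then 1 else 0

theorem toZMod_injective : Function.Injective toZMod := by decide

theorem toZMod_xor (a b : Bool) : toZMod (a ^^ b) = toZMod a + toZMod b := by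
  revert a b; decide

theorem toZMod_and (a b : Bool) : toZMod (a && b) = toZMod a * toZMod b := by
  revert a b; decide

theorem toZMod_decide (z : ZMod 2) : toZMod (decide (z = 1)) = z := by
  revert z; decide

/-- The point of `F_2^6` whose coordinates are the bits of `p`. -/
def bitVec (p : ℕ) (i : Fin 6) : ZMod 2 := toZMod (p.testBit i)

theorem bitVec_bijective : Function.Bijective fun p : Fin 64 => bitVec p := by
  refine (Fintype.bijective_iff_injective_and_card _).2 ⟨fun p q h => ?_, by simp⟩
  refine Fin.ext (Nat.eq_of_testBit_eq fun i => ?_)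
  rcases Nat.lt_or_ge i 6 with hi | hi
  · exact toZMod_injective (congrFun h ⟨i, hi⟩)
  · have : 2 ^ 6 ≤ 2 ^ i := Nat.pow_le_pow_right (by norm_num) hi
    rw [Nat.testBit_lt_two_pow (by omega), Nat.testBit_lt_two_pow (by omega)]

theorem hd_eq_sum {F G : BF 6} {f g : ℕ → Bool} (hF : ∀ p, F (bitVec p) = toZMod (f p))
    (hG : ∀ p, G (bitVec p) = toZMod (g p)) :
    hd F G = ∑ p ∈ Finset.range 64, (f p ^^ g p).toNat := by
  rw [hd, Finset.card_filter, Finset.sum_range, ← bitVec_bijective.sum_comp]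
  refine Finset.sum_congr rfl fun p _ => ?_
  simp only [hF, hG, toZMod_injective.ne_iff]
  cases f p <;> cases g p <;> rfl

/-- The sum of the functions `m k` for which the `k`-th bit of `c` is one. -/
def bitComb {n : ℕ} (m : Fin n → BF 6) (c : ℕ) : BF 6 := ∑ k : Fin n, toZMod (c.testBit k) • m k

theorem bitComb_apply {n : ℕ} (m : Fin n → BF 6) (c : ℕ) (x : Fin 6 → ZMod 2) :
    bitComb m c x = ∑ k : Fin n, toZMod (c.testBit k) * m k x := by
  simp [bitComb]

theorem bitComb_xor {n : ℕ} (m : Fin n → BF 6) (a b : ℕ) :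
    bitComb m (a ^^^ b) = bitComb m a + bitComb m b := by
  simp only [bitComb, Nat.testBit_xor, toZMod_xor, add_smul, Finset.sum_add_distrib]

theorem mem_span_iff_exists_bitComb {n : ℕ} {m : Fin n → BF 6} {F : BF 6} :
    F ∈ Submodule.span (ZMod 2) (Set.range m) ↔ ∃ c < 2 ^ n, bitComb m c = F := by
  rw [Submodule.mem_span_range_iff_exists_fun]
  constructor
  · rintro ⟨z, rfl⟩
    refine ⟨Nat.ofBits fun k => decide (z k = 1), Nat.ofBits_lt_two_pow _, ?_⟩
    simp only [bitComb, Nat.testBit_ofBits_lt _ _ (Fin.is_lt _), Fin.eta, toZMod_decide]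
  · rintro ⟨c, -, rfl⟩
    exact ⟨_, rfl⟩

/-- The index pairs of the quadratic monomials in reverse lexicographic order. -/
def monoPair : Fin 15 → Fin 6 × Fin 6 :=
  ![(4, 5), (3, 5), (3, 4), (2, 5), (2, 4), (2, 3), (1, 5), (1, 4), (1, 3), (1, 2), (0, 5), (0, 4),
    (0, 3), (0, 2), (0, 1)]

def quadMono (k : Fin 15) : BF 6 := fun x => x (monoPair k).1 * x (monoPair k).2

theorem bitComb_quadMono (c p : ℕ) :
    bitComb quadMono c (bitVec p) = toZMod (bitForm (quadMonos p) c) := by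
  simp [bitComb_apply, Fin.sum_univ_succ, bitForm, quadMonos, toZMod_xor, toZMod_and, quadMono,
    monoPair, bitVec]
  ring

theorem homQuad_iff_mem_span {F : BF 6} :
    HomQuad F ↔ F ∈ Submodule.span (ZMod 2) (Set.range quadMono) := by
  constructor
  · rintro ⟨a, ha⟩
    have hF : F = ∑ i, ∑ j, if i < j then a i j • (fun x => x i * x j : BF 6) else 0 := by
      funext x
      simp only [ha, Finset.sum_apply, mul_assoc]
      refine Finset.sum_congr rfl fun i _ => Finset.sum_congr rfl fun j _ => ?_
      split_ifs <;> rfl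
    rw [hF]
    refine Submodule.sum_mem _ fun i _ => Submodule.sum_mem _ fun j _ => ?_
    split_ifs with hij
    · have : ∀ i j, i < j → ∃ k, monoPair k = (i, j) := by decide
      obtain ⟨k, hk⟩ := this i j hij
      refine Submodule.smul_mem _ _ (Submodule.subset_span ⟨k, ?_⟩)
      funext x
      rw [quadMono, hk]
    · exact Submodule.zero_mem _
  · intro hF
    induction hF using Submodule.span_induction with
    | mem F hF =>
      obtain ⟨k, rfl⟩ := hF
      refine ⟨fun i j => if monoPair k = (i, j) then 1 else 0, fun x => ?_⟩
      have hlt : ∀ k, (monoPair k).1 < (monoPair k).2 := by decide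
      rw [Finset.sum_eq_single (monoPair k).1, Finset.sum_eq_single (monoPair k).2]
      · simp [hlt, quadMono]
      · intro j _ hj
        simp [Prod.ext_iff, hj.symm]
      · simp
      · intro i _ hi
        simp [Prod.ext_iff, hi.symm]
      · simp
    | zero => exact ⟨0, fun x => by simp⟩
    | add F G _ _ hF hG =>
      obtain ⟨a, ha⟩ := hF
      obtain ⟨b, hb⟩ := hG
      refine ⟨a + b, fun x => ?_⟩
      rw [Pi.add_apply, ha, hb]
      simp only [← Finset.sum_add_distrib, Pi.add_apply, add_mul]
      refine Finset.sum_congr rfl fun i _ => Finset.sum_congr rfl fun j _ => ?_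
      split_ifs <;> simp
    | smul z F _ hF =>
      obtain ⟨a, ha⟩ := hF
      refine ⟨z • a, fun x => ?_⟩
      rw [Pi.smul_apply, ha]
      simp only [Finset.mul_sum, Pi.smul_apply, smul_eq_mul, mul_assoc, mul_ite, mul_zero]

theorem bitComb_quadMono_injOn :
    Set.InjOn (bitComb quadMono) {c | c < 2 ^ 15} := by
  have hδ : ∀ k l : Fin 15,
      quadMono l (fun i => if i = (monoPair k).1 ∨ i = (monoPair k).2 then 1 else 0) =
        if l = k then 1 else 0 := by decide
  intro a ha b hb h
  refine Nat.eq_of_testBit_eq fun i => ?_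
  rcases Nat.lt_or_ge i 15 with hi | hi
  · have := congrFun h fun j => if j = (monoPair ⟨i, hi⟩).1 ∨ j = (monoPair ⟨i, hi⟩).2 then 1 else 0
    simp only [bitComb_apply, hδ, mul_ite, mul_one, mul_zero, Finset.sum_ite_eq',
      Finset.mem_univ, if_true] at this
    exact toZMod_injective this
  · have := Nat.pow_le_pow_right (show 0 < 2 by norm_num) hi
    rw [Nat.testBit_lt_two_pow (ha.trans_le this), Nat.testBit_lt_two_pow (hb.trans_le this)]

/-- The coordinate functions and the constant function one. -/
def affMono (k : Fin 7) : BF 6 := fun x => if h : (k : ℕ) < 6 then x ⟨k, h⟩ else 1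

theorem bitComb_affMono (a p : ℕ) : bitComb affMono a (bitVec p) = toZMod (affFun a p) := by
  simp [bitComb_apply, Fin.sum_univ_succ, affFun, bitDot, toZMod_xor, toZMod_and, affMono, bitVec]
  ring

theorem mem_RM_one_iff_mem_span {F : BF 6} :
    F ∈ RM 1 6 ↔ F ∈ Submodule.span (ZMod 2) (Set.range affMono) := by
  constructor
  · rintro ⟨p, hp, hF⟩
    have hF : F = ∑ d ∈ p.support, p.coeff d • (fun x => ∏ i, x i ^ d i : BF 6) := by
      funext x
      simp [hF, MvPolynomial.eval_eq']
    rw [hF]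
    refine Submodule.sum_mem _ fun d hd => Submodule.smul_mem _ _ (Submodule.subset_span ?_)
    have hd : d.degree ≤ 1 := (MvPolynomial.le_totalDegree hd).trans hp
    rcases Nat.le_one_iff_eq_zero_or_eq_one.1 hd with hd | hd
    · refine ⟨6, ?_⟩
      obtain rfl := (Finsupp.degree_eq_zero_iff d).1 hd
      funext x
      simp [affMono]
    · obtain ⟨i, rfl⟩ := (Finsupp.sum_eq_one_iff d).1 hd
      refine ⟨i.castSucc, ?_⟩
      funext x
      simp [affMono, Finsupp.single_apply, pow_ite]
  · rw [Submodule.mem_span_range_iff_exists_fun]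
    rintro ⟨z, rfl⟩
    refine ⟨∑ k : Fin 7, z k • if h : (k : ℕ) < 6 then MvPolynomial.X ⟨k, h⟩ else 1, ?_,
      fun x => ?_⟩
    · refine MvPolynomial.totalDegree_finsetSum_le fun k _ =>
        (MvPolynomial.totalDegree_smul_le _ _).trans ?_
      split_ifs <;> simp
    · simp only [Finset.sum_apply, map_sum, Pi.smul_apply, MvPolynomial.smul_eval, smul_eq_mul]
      refine Finset.sum_congr rfl fun k _ => ?_
      rw [affMono]
      split_ifs <;> simp

theorem nl_one_eq_iff {F : BF 6} {f : ℕ → Bool} (hF : ∀ p, F (bitVec p) = toZMod (f p)) (r : ℕ) :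
    nl 1 F = r ↔ HasNl f r := by
  have hdist (a : ℕ) : hd F (bitComb affMono a) = affDist f a := hd_eq_sum hF (bitComb_affMono a)
  have hset : {d | ∃ G ∈ RM 1 6, d = hd F G} = {d | ∃ a < 128, d = affDist f a} := by
    ext d
    simp only [Set.mem_ofPred_eq, mem_RM_one_iff_mem_span, mem_span_iff_exists_bitComb,
      show 2 ^ 7 = 128 by norm_num]
    constructor
    · rintro ⟨_, ⟨a, ha, rfl⟩, rfl⟩
      exact ⟨a, ha, hdist a⟩
    · rintro ⟨a, ha, h⟩
      exact ⟨_, ⟨a, ha, rfl⟩, h.trans (hdist a).symm⟩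
  have hle (s : ℕ) : s ≤ nl 1 F ↔ ∀ a < 128, s ≤ affDist f a := by
    have hne : {d | ∃ a < 128, d = affDist f a}.Nonempty := ⟨affDist f 0, 0, by norm_num, rfl⟩
    rw [nl, hset, le_csInf_iff (OrderBot.bddBelow _) hne]
    exact ⟨fun h a ha => h _ ⟨a, ha, rfl⟩, fun h _ ⟨a, ha, hd⟩ => hd ▸ h a ha⟩
  rw [HasNl, ← hle, ← hle]
  omega

theorem ncard_translate_inter_S16 {F : BF 6} {f : ℕ → Bool} {r N : ℕ}
    (hF : ∀ p, F (bitVec p) = toZMod (f p)) (hr : r < 64) (h : nlCheck f r N = true) {g : BF 6}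
    (hg : g ∈ Fh F r) : (((fun h => g + h) '' Fh F r) ∩ S16).ncard = N := by
  have hnl (c : ℕ) : nl 1 (F + bitComb quadMono c) = r ↔ HasNl (addQuad f c) r :=
    nl_one_eq_iff (fun p => by rw [Pi.add_apply, hF, bitComb_quadMono, addQuad, toZMod_xor]) r
  have hS (c : ℕ) : bitComb quadMono c ∈ S16 ↔ HasNl (addQuad (fun _ => false) c) 16 :=
    nl_one_eq_iff (fun p => by rw [bitComb_quadMono, addQuad, Bool.false_xor]) 16
  have hFh : Fh F r = bitComb quadMono '' {c | c < 2 ^ 15 ∧ HasNl (addQuad f c) r} := by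
    ext G
    constructor
    · rintro ⟨hG, hGr⟩
      obtain ⟨c, hc, rfl⟩ := mem_span_iff_exists_bitComb.1 (homQuad_iff_mem_span.1 hG)
      exact ⟨c, ⟨hc, (hnl c).1 hGr⟩, rfl⟩
    · rintro ⟨c, ⟨hc, hcr⟩, rfl⟩
      exact ⟨homQuad_iff_mem_span.2 (mem_span_iff_exists_bitComb.2 ⟨c, hc, rfl⟩), (hnl c).2 hcr⟩
  rw [hFh] at hg ⊢
  obtain ⟨a, ⟨ha, har⟩, rfl⟩ := hg
  rw [← nlCheck_spec hr h ha har, ← Set.ncard_coe_finset,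
    ← Set.InjOn.ncard_image (f := fun c => bitComb quadMono a + bitComb quadMono c)]
  · congr 1
    ext G
    simp only [Set.mem_inter_iff, Set.mem_image, Finset.coe_filter, Finset.mem_range,
      Set.mem_ofPred_eq]
    constructor
    · rintro ⟨⟨_, ⟨c, ⟨hc, hcr⟩, rfl⟩, rfl⟩, hG⟩
      rw [← bitComb_xor, hS, Nat.xor_comm] at hG
      exact ⟨c, ⟨hc, hcr, hG⟩, rfl⟩
    · rintro ⟨c, ⟨hc, hcr, hG⟩, rfl⟩
      refine ⟨⟨_, ⟨c, ⟨hc, hcr⟩, rfl⟩, rfl⟩, ?_⟩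
      rwa [← bitComb_xor, hS, Nat.xor_comm]
  · intro b hb c hc h
    simp only [Finset.coe_filter, Finset.mem_range, Set.mem_ofPred_eq] at hb hc
    exact bitComb_quadMono_injOn hb.1 hc.1 (add_left_cancel h)

theorem fun1_bitVec (p : ℕ) : fun1 (bitVec p) = toZMod (boolFun1 p) := by
  simp only [fun1, boolFun1, toZMod_xor, toZMod_and]
  rfl

theorem fun2_bitVec (p : ℕ) : fun2 (bitVec p) = toZMod (boolFun2 p) := by
  simp only [fun2, boolFun2, toZMod_xor, toZMod_and]
  rfl

theorem fun4_bitVec (p : ℕ) : fun4 (bitVec p) = toZMod (boolFun4 p) := by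
  simp only [fun4, boolFun4, toZMod_xor, toZMod_and]
  rfl

/-- Counting values for translates of `Fh` intersected with `S16`. -/
theorem stmt9 :
    (∀ g1 ∈ Fh fun1 28, (((fun h => g1 + h) '' Fh fun1 28) ∩ S16).ncard = 7) ∧
    (∀ g2 ∈ Fh fun2 26, (((fun h => g2 + h) '' Fh fun2 26) ∩ S16).ncard = 55) ∧
    (∀ g4 ∈ Fh fun4 26, (((fun h => g4 + h) '' Fh fun4 26) ∩ S16).ncard = 21) := by
  refine ⟨fun g hg => ?_, fun g hg => ?_, fun g hg => ?_⟩
  · exact ncard_translate_inter_S16 fun1_bitVec (by norm_num) nlCheck_boolFun1 hg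
  · exact ncard_translate_inter_S16 fun2_bitVec (by norm_num) nlCheck_boolFun2 hg
  · exact ncard_translate_inter_S16 fun4_bitVec (by norm_num) nlCheck_boolFun4 hg
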